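/- arXiv:2601.15068 — 3 statements merged into one kernel-verified Lean document; each statement's English description precedes it below -/
import Mathlib

section
/- Fix T_min > 0, an integer α ≥ 0 and β ∈ [0,1), and set T̂ = 2^{α+β}·T_min. Then the integral over θ ∈ [−1/2, 1/2] of the power-of-2 rounded value T^θ equals T̂/(√2·ln 2); that is, ∫_{β−1/2}^{1/2} 2^{α+θ}·T_min dθ + ∫_{−1/2}^{β−1/2} 2^{α+θ+1}·T_min dθ = (1/(√2·ln 2))·T̂. Equivalently, if Θ is uniformly distributed on [−1/2, 1/2], then E[T^Θ] = T̂/(√2·ln 2). -/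
open intervalIntegral Real

/-- The integral of an exponential function with positive base over an interval. -/
theorem integral_const_rpow_add {r : ℝ} (hr : 0 < r) (hr1 : r ≠ 1) (c a b : ℝ) :
    ∫ x in a..b, r ^ (c + x) = (r ^ (c + b) - r ^ (c + a)) / Real.log r := by
  have hlog : Real.log r ≠ 0 := Real.log_ne_zero_of_pos_of_ne_one hr hr1
  have hderiv (x : ℝ) : HasDerivAt (fun y : ℝ => r ^ (c + y) / Real.log r) (r ^ (c + x)) x := by
    have h := (((hasDerivAt_id x).const_add c).const_rpow hr).div_const (Real.log r)
    simpa [hlog] using h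
  have hcont : Continuous fun x : ℝ => r ^ (c + x) :=
    continuous_const.rpow (by fun_prop) fun _ => Or.inl hr.ne'
  rw [integral_eq_sub_of_hasDerivAt (fun x _ => hderiv x) (hcont.intervalIntegrable a b), sub_div]

/-- Power-of-2 rounding: with `T̂ = 2^(α+β)·T_min`, the expectation of the
rounded value `T^Θ` over `Θ ~ U[−1/2, 1/2]` equals `T̂/(√2·ln 2)`, stated as
an integral identity. -/
theorem po2_rounding_expectation (Tmin : ℝ) (hTmin : 0 < Tmin)
    (α : ℕ) (β : ℝ) (hβ : β ∈ Set.Ico (0 : ℝ) 1) :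
    (∫ θ in (β - 1/2 : ℝ)..(1/2 : ℝ), (2 : ℝ) ^ ((α : ℝ) + θ) * Tmin) +
      (∫ θ in (-(1/2) : ℝ)..(β - 1/2 : ℝ), (2 : ℝ) ^ ((α : ℝ) + θ + 1) * Tmin) =
      (1 / (Real.sqrt 2 * Real.log 2)) * ((2 : ℝ) ^ ((α : ℝ) + β) * Tmin) := by
  have htwo : (2 : ℝ) ≠ 1 := by norm_num
  have hshift (θ : ℝ) : (α : ℝ) + θ + 1 = ((α : ℝ) + 1) + θ := by ring
  have hsqrt : (2 : ℝ) ^ (1 / 2 : ℝ) = √2 := (Real.sqrt_eq_rpow 2).symm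
  have hlower : (2 : ℝ) ^ ((α : ℝ) + (β - 1 / 2)) = 2 ^ ((α : ℝ) + β) / √2 := by
    rw [← hsqrt, ← Real.rpow_sub two_pos]
    ring_nf
  have hupper : (2 : ℝ) ^ ((α : ℝ) + 1 + (β - 1 / 2)) = 2 ^ ((α : ℝ) + β) * √2 := by
    rw [← hsqrt, ← Real.rpow_add two_pos]
    ring_nf
  have hends : (α : ℝ) + 1 + -(1 / 2) = α + 1 / 2 := by ring
  simp only [hshift, intervalIntegral.integral_mul_const,
    integral_const_rpow_add two_pos htwo, hlower, hupper, hends]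
  have hlog : Real.log 2 ≠ 0 := (Real.log_pos one_lt_two).ne'
  have hsq : √(2 : ℝ) ^ 2 = 2 := Real.sq_sqrt zero_le_two
  field_simp
  linear_combination (2 : ℝ) ^ ((α : ℝ) + β) * hsq
end

section
/- Fix T_min > 0, an integer α ≥ 0 and β ∈ [0,1), and set T̂ = 2^{α+β}·T_min. Then the integral over θ ∈ [−1/2, 1/2] of the reciprocal of the power-of-2 rounded value equals 1/(√2·ln 2·T̂); that is, if Θ is uniformly distributed on [−1/2, 1/2], then E[1/T^Θ] = (1/(√2·ln 2))·(1/T̂). -/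
open intervalIntegral Real

/-- Integral of the reciprocal of a shifted and scaled exponential function. -/
theorem integral_one_div_rpow_add_mul {r : ℝ} (hr : 0 < r) (hr1 : r ≠ 1) (c T a b : ℝ) :
    ∫ θ in a..b, 1 / (r ^ (c + θ) * T) =
      (r ^ (-(c + a)) - r ^ (-(c + b))) / (Real.log r * T) := by
  have hlog : Real.log r ≠ 0 := Real.log_ne_zero_of_pos_of_ne_one hr hr1
  have hderiv (x : ℝ) : HasDerivAt (fun x : ℝ => -r ^ (-(c + x)) / (Real.log r * T))
      (r ^ (-(c + x)) / T) x := by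
    have h := ((((hasDerivAt_id x).const_add c).neg.const_rpow hr).neg).div_const
      (Real.log r * T)
    refine h.congr_deriv ?_
    change -(log r * -1 * r ^ (-(c + x))) / (log r * T) = _
    field_simp
  have hcont : Continuous fun x : ℝ => r ^ (-(c + x)) / T :=
    (continuous_const.rpow (by fun_prop) fun _ => Or.inl hr.ne').div_const T
  have hfun : (fun θ : ℝ => 1 / (r ^ (c + θ) * T)) = fun θ => r ^ (-(c + θ)) / T := by
    funext θ
    rw [Real.rpow_neg hr.le, ← div_div, one_div]
  rw [hfun, integral_eq_sub_of_hasDerivAt (fun x _ => hderiv x) (hcont.intervalIntegrable a b)]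
  ring

/-- Power-of-2 rounding: with `T̂ = 2^(α+β)·T_min`, the expectation of the
reciprocal of the rounded value `T^Θ` over `Θ ~ U[−1/2, 1/2]` equals
`(1/(√2·ln 2))·(1/T̂)`, stated as an integral identity. -/
theorem po2_rounding_reciprocal_expectation (Tmin : ℝ) (hTmin : 0 < Tmin)
    (α : ℕ) (β : ℝ) (hβ : β ∈ Set.Ico (0 : ℝ) 1) :
    (∫ θ in (β - 1/2 : ℝ)..(1/2 : ℝ), 1 / ((2 : ℝ) ^ ((α : ℝ) + θ) * Tmin)) +
      (∫ θ in (-(1/2) : ℝ)..(β - 1/2 : ℝ),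
        1 / ((2 : ℝ) ^ ((α : ℝ) + θ + 1) * Tmin)) =
      (1 / (Real.sqrt 2 * Real.log 2)) *
        (1 / ((2 : ℝ) ^ ((α : ℝ) + β) * Tmin)) := by
  simp only [add_right_comm (α : ℝ) _ 1]
  rw [integral_one_div_rpow_add_mul two_pos (by norm_num),
    integral_one_div_rpow_add_mul two_pos (by norm_num)]
  have hsq : √2 * √2 = (2 : ℝ) := Real.mul_self_sqrt two_pos.le
  have hsqrt : (2 : ℝ) ^ (1 / 2 : ℝ) = √2 := (Real.sqrt_eq_rpow 2).symm
  have hlower : (2 : ℝ) ^ (-((α : ℝ) + (β - 1 / 2))) = √2 * ((2 : ℝ) ^ ((α : ℝ) + β))⁻¹ := by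
    rw [← hsqrt, ← Real.rpow_neg two_pos.le, ← Real.rpow_add two_pos]
    ring_nf
  have hupper : (2 : ℝ) ^ (-((α : ℝ) + 1 + (β - 1 / 2))) =
      √2 * ((2 : ℝ) ^ ((α : ℝ) + β))⁻¹ / 2 := by
    rw [← hlower, ← Real.rpow_sub_one two_ne_zero]
    ring_nf
  have hmid : (α : ℝ) + 1 + -(1 / 2) = α + 1 / 2 := by ring
  have hlog : Real.log 2 ≠ 0 := (Real.log_pos one_lt_two).ne'
  have hpow : (2 : ℝ) ^ ((α : ℝ) + β) ≠ 0 := (Real.rpow_pos_of_pos two_pos _).ne'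
  have hinv : √2 - √2 / 2 = 1 / √2 := by
    field_simp
    linarith
  rw [hlower, hupper, hmid, ← add_div, sub_add_sub_cancel]
  calc
    _ = (√2 - √2 / 2) * ((2 : ℝ) ^ ((α : ℝ) + β))⁻¹ / (Real.log 2 * Tmin) := by ring
    _ = _ := by
      rw [hinv]
      field_simp
end

section
/- Let ε ∈ (0, 1/10], set Δ = ⌈ln(125/ε⁷)/ln(1+ε)⌉, and let ℓ̂ ≥ 1 and m be natural numbers with m ≥ ℓ̂ + Δ − 1. Let (n_ℓ)_{ℓ ≥ m+1} be reals with 0 ≤ n_ℓ ≤ 100·ln(1/ε)/ε⁴ for every ℓ. Then ∑_{ℓ = m+1}^{∞} n_ℓ · (1+ε)^{−(ℓ−1)} ≤ ε · (1+ε)^{−ℓ̂}. -/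
/-- A geometric tail with coefficients in `[0, C]` is at most `C` times the full geometric tail. -/
lemma tsum_mul_zpow_neg_le {q C : ℝ} (hq : 1 < q) (m : ℕ) {a : ℕ → ℝ}
    (ha : ∀ k, 0 ≤ a k ∧ a k ≤ C) :
    ∑' k : ℕ, a k * q ^ (-((m : ℤ) + k)) ≤ C * (q ^ m)⁻¹ * (q / (q - 1)) := by
  have hq0 : 0 < q := by linarith
  have hterm (k : ℕ) : q ^ (-((m : ℤ) + k)) = (q ^ m)⁻¹ * q⁻¹ ^ k := by
    rw [neg_add, zpow_add₀ hq0.ne', zpow_neg, zpow_neg, zpow_natCast, zpow_natCast, inv_pow]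
  have hgeom : HasSum (fun k : ℕ => C * (q ^ m)⁻¹ * q⁻¹ ^ k) (C * (q ^ m)⁻¹ * (q / (q - 1))) := by
    have h := (hasSum_geometric_of_lt_one (inv_nonneg.2 hq0.le)
      (inv_lt_one_of_one_lt₀ hq)).mul_left (C * (q ^ m)⁻¹)
    have hq1 : q - 1 ≠ 0 := by linarith
    have hsum : (1 - q⁻¹)⁻¹ = q / (q - 1) := by
      rw [show 1 - q⁻¹ = (q - 1) / q by field_simp, inv_div]
    rwa [hsum] at h
  have hle (k : ℕ) : a k * q ^ (-((m : ℤ) + k)) ≤ C * (q ^ m)⁻¹ * q⁻¹ ^ k := by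
    rw [hterm, mul_assoc]
    exact mul_le_mul_of_nonneg_right (ha k).2 (by positivity)
  have hnonneg (k : ℕ) : 0 ≤ a k * q ^ (-((m : ℤ) + k)) :=
    mul_nonneg (ha k).1 (by positivity)
  rw [← hgeom.tsum_eq]
  exact (Summable.of_nonneg_of_le hnonneg hle hgeom.summable).tsum_le_tsum hle hgeom.summable

lemma le_pow_ceil_log_div_log {q x : ℝ} (hq : 1 < q) (hx : 0 < x) :
    x ≤ q ^ ⌈Real.log x / Real.log q⌉₊ := by
  have hq0 : 0 < q := by linarith
  rw [← Real.log_le_log_iff hx (by positivity), Real.log_pow,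
    ← div_le_iff₀ (Real.log_pos hq)]
  exact Nat.le_ceil _

/-- Geometric-tail estimate for suffix-sparse volume classes: with
`Δ = ⌈ln(125/ε⁷)/ln(1+ε)⌉` and `m ≥ ℓ̂ + Δ − 1`, if each `n_ℓ` lies in
`[0, 100·ln(1/ε)/ε⁴]`, then `∑_{ℓ=m+1}^∞ n_ℓ·(1+ε)^{−(ℓ−1)} ≤ ε·(1+ε)^{−ℓ̂}`. -/
theorem suffix_sparse_tail_bound (ε : ℝ) (hε : ε ∈ Set.Ioc (0 : ℝ) (1/10))
    (lhat m : ℕ) (hlhat : 1 ≤ lhat)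
    (hm : m ≥ lhat + ⌈Real.log (125 / ε ^ 7) / Real.log (1 + ε)⌉₊ - 1)
    (n : ℕ → ℝ)
    (hn : ∀ ℓ, 0 ≤ n ℓ ∧ n ℓ ≤ 100 * Real.log (1 / ε) / ε ^ 4) :
    ∑' k : ℕ, n (m + 1 + k) * (1 + ε) ^ (-((m : ℤ) + k)) ≤
      ε * (1 + ε) ^ (-(lhat : ℤ)) := by
  obtain ⟨hε0, hε1⟩ := hε
  have hq : 1 < 1 + ε := by linarith
  set L := Real.log (1 / ε)
  have hL0 : 0 ≤ L := Real.log_nonneg (by rw [le_div_iff₀ hε0]; linarith)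
  have hLε : ε * L ≤ 1 := by
    have h := Real.log_le_sub_one_of_pos (one_div_pos.2 hε0)
    calc ε * L ≤ ε * (1 / ε - 1) := by gcongr
      _ = 1 - ε := by field_simp
      _ ≤ 1 := by linarith
  have hpow : (1 + ε) ^ lhat * (125 / ε ^ 7) ≤ (1 + ε) ^ m * (1 + ε) := by
    calc _ ≤ (1 + ε) ^ lhat * (1 + ε) ^ ⌈Real.log (125 / ε ^ 7) / Real.log (1 + ε)⌉₊ := by
          gcongr
          exact le_pow_ceil_log_div_log hq (by positivity)
      _ ≤ (1 + ε) ^ (m + 1) := by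
          rw [← pow_add]
          exact pow_le_pow_right₀ hq.le (by omega)
      _ = _ := pow_succ _ _
  have hinv : ((1 + ε) ^ m)⁻¹ ≤ ((1 + ε) ^ lhat)⁻¹ * ((1 + ε) * ε ^ 7 / 125) := by
    rw [inv_mul_eq_div, le_div_iff₀ (by positivity), inv_mul_le_iff₀ (by positivity)]
    rw [mul_div_assoc', div_le_iff₀ (by positivity)] at hpow
    linarith
  refine (tsum_mul_zpow_neg_le hq m fun k => hn (m + 1 + k)).trans ?_
  rw [zpow_neg, zpow_natCast, add_sub_cancel_left]
  calc 100 * L / ε ^ 4 * ((1 + ε) ^ m)⁻¹ * ((1 + ε) / ε)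
      ≤ 100 * L / ε ^ 4 * (((1 + ε) ^ lhat)⁻¹ * ((1 + ε) * ε ^ 7 / 125)) * ((1 + ε) / ε) := by
        gcongr
    _ = (4 / 5 * (1 + ε) ^ 2 * (ε * L)) * (ε * ((1 + ε) ^ lhat)⁻¹) := by
        field_simp
        ring
    _ ≤ 1 * (ε * ((1 + ε) ^ lhat)⁻¹) := by
        gcongr
        calc 4 / 5 * (1 + ε) ^ 2 * (ε * L) ≤ 4 / 5 * (1 + 1 / 10) ^ 2 * 1 := by gcongr
          _ ≤ 1 := by norm_num
    _ = ε * ((1 + ε) ^ lhat)⁻¹ := one_mul _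
end
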